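/- arXiv:1404.3692 — 2 statements merged into one kernel-verified Lean document; each statement's English description precedes it below -/
import Mathlib

section
/- (Subsolutions lie below the value function.) Assume in addition f(x) ≥ 0 for all x ∈ V and that every vertex of V can be joined to some vertex of Γ by a path in G, and let g : Γ → ℝ satisfy the discrete compatibility condition: g(x) ≤ h·Σ_{k=0}^{N−1} f(x_k) + g(y) for all x, y ∈ Γ and every path x₀ = x, …, x_N = y in G. Define U(x) := inf { h·Σ_{k=0}^{N−1} f(x_k) + g(y) }, the infimum taken over all y ∈ Γ and all paths from x to y. If u is a subsolution of |Du|ₕ = f on V₀ with u ≤ g on Γ, then u(x) ≤ U(x) for every x ∈ V. -/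
open Finset

variable {V : Type*}

/-- The discrete gradient `|Du(x)|ₕ = max_{y ∼ x} (u(x) − u(y))/h`
(as a supremum over the neighbours of `x`). -/
noncomputable def discGrad (G : SimpleGraph V) (h : ℝ) (u : V → ℝ) (x : V) : ℝ :=
  sSup ((fun y => (u x - u y) / h) '' {y | G.Adj x y})

/-- A path of length `N` in the graph `G` from `x` to `y`. -/
def IsGraphPath (G : SimpleGraph V) (N : ℕ) (p : ℕ → V) (x y : V) : Prop :=
  p 0 = x ∧ p N = y ∧ ∀ i < N, G.Adj (p i) (p (i + 1))

/-- The cost of a path of length `N`: `h·Σ_{k=0}^{N−1} f(x_k) + g(x_N)`. -/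
noncomputable def pathCost (h : ℝ) (f g : V → ℝ) (N : ℕ) (p : ℕ → V) : ℝ :=
  h * ∑ k ∈ Finset.range N, f (p k) + g (p N)

/-- The value function `U(x)`: infimum of the path costs over all boundary
vertices `y ∈ Γ` and all paths from `x` to `y`. -/
noncomputable def valueFun (G : SimpleGraph V) (Γ : Finset V) (h : ℝ) (f g : V → ℝ)
    (x : V) : ℝ :=
  sInf {c : ℝ | ∃ y ∈ Γ, ∃ N : ℕ, ∃ p : ℕ → V,
    IsGraphPath G N p x y ∧ c = pathCost h f g N p}

/-- A bound on the discrete gradient bounds the drop of `u` along each edge. -/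
theorem le_add_of_discGrad_le [Finite V] {G : SimpleGraph V} {h : ℝ} (hh : 0 < h)
    {u : V → ℝ} {x y : V} {c : ℝ} (hu : discGrad G h u x ≤ c) (hxy : G.Adj x y) :
    u x ≤ h * c + u y := by
  have hle : (u x - u y) / h ≤ discGrad G h u x :=
    le_csSup (Set.toFinite _).bddAbove ⟨y, hxy, rfl⟩
  have := (div_le_iff₀' hh).mp (hle.trans hu)
  linarith

/-- Dropping the first vertex of a graph path. -/
theorem IsGraphPath.tail {G : SimpleGraph V} {N : ℕ} {p : ℕ → V} {x y : V}
    (hp : IsGraphPath G (N + 1) p x y) :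
    IsGraphPath G N (fun i => p (i + 1)) (p 1) y :=
  ⟨rfl, hp.2.1, fun i hi => hp.2.2 (i + 1) (by omega)⟩

/-- The dynamic programming recursion for the path cost. -/
theorem pathCost_succ (h : ℝ) (f g : V → ℝ) (N : ℕ) (p : ℕ → V) :
    pathCost h f g (N + 1) p = h * f (p 0) + pathCost h f g N (fun i => p (i + 1)) := by
  simp only [pathCost, Finset.sum_range_succ']
  ring

/-- A subsolution lies below the cost of every path ending on the boundary. -/
theorem subsolution_le_pathCost [Finite V] {G : SimpleGraph V} {Γ : Finset V} {h : ℝ}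
    (hh : 0 < h) {f g u : V → ℝ}
    (hcompat : ∀ x ∈ Γ, ∀ y ∈ Γ, ∀ N : ℕ, ∀ p : ℕ → V,
      IsGraphPath G N p x y → g x ≤ pathCost h f g N p)
    (hu : ∀ x ∉ Γ, discGrad G h u x ≤ f x) (hbd : ∀ x ∈ Γ, u x ≤ g x)
    {y : V} (hy : y ∈ Γ) {N : ℕ} {p : ℕ → V} {x : V} (hp : IsGraphPath G N p x y) :
    u x ≤ pathCost h f g N p := by
  induction N generalizing p x with
  | zero =>
    have hx : x ∈ Γ := by rwa [← hp.1, hp.2.1]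
    exact (hbd x hx).trans (hcompat x hx y hy 0 p hp)
  | succ N ih =>
    by_cases hx : x ∈ Γ
    · exact (hbd x hx).trans (hcompat x hx y hy _ p hp)
    · have hadj : G.Adj x (p 1) := by simpa [hp.1] using hp.2.2 0 N.succ_pos
      rw [pathCost_succ, hp.1]
      linarith [le_add_of_discGrad_le hh (hu x hx) hadj, ih hp.tail]

/-- Subsolutions lie below the value function: if `u` is a subsolution of
`|Du|ₕ = f` on `V₀` with `u ≤ g` on `Γ`, then `u ≤ U` on `V`. -/
theorem subsolution_le_valueFun [Fintype V] [Nonempty V]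
    (G : SimpleGraph V) (Γ : Finset V) (hΓ : Γ.Nonempty)
    (hnb : ∀ x ∉ Γ, ∃ y, G.Adj x y)
    (h : ℝ) (hh : 0 < h)
    (f : V → ℝ) (hf0 : ∀ x ∉ Γ, 0 < f x) (hf : ∀ x, 0 ≤ f x)
    (hreach : ∀ x : V, ∃ y ∈ Γ, ∃ N : ℕ, ∃ p : ℕ → V, IsGraphPath G N p x y)
    (g : V → ℝ)
    (hcompat : ∀ x ∈ Γ, ∀ y ∈ Γ, ∀ N : ℕ, ∀ p : ℕ → V,
      IsGraphPath G N p x y → g x ≤ pathCost h f g N p)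
    (u : V → ℝ)
    (hu : ∀ x ∉ Γ, discGrad G h u x ≤ f x)
    (hbd : ∀ x ∈ Γ, u x ≤ g x) :
    ∀ x : V, u x ≤ valueFun G Γ h f g x := by
  intro x
  obtain ⟨y, hy, N, p, hp⟩ := hreach x
  refine le_csInf ⟨_, y, hy, N, p, hp, rfl⟩ ?_
  rintro _ ⟨y, hy, N, p, hp, rfl⟩
  exact subsolution_le_pathCost hh hcompat hu hbd hy hp
end

section
/- (Supersolutions lie above the value function.) Assume in addition f(x) ≥ 0 for all x ∈ V and that every vertex of V can be joined to some vertex of Γ by a path in G, and let g : Γ → ℝ satisfy the discrete compatibility condition: g(x) ≤ h·Σ_{k=0}^{N−1} f(x_k) + g(y) for all x, y ∈ Γ and every path x₀ = x, …, x_N = y in G. Define U(x) := inf { h·Σ_{k=0}^{N−1} f(x_k) + g(y) }, the infimum taken over all y ∈ Γ and all paths from x to y. If v is a supersolution of |Du|ₕ = f on V₀ with v ≥ g on Γ, then v(x) ≥ U(x) for every x ∈ V. -/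
open Finset

variable {V : Type*}

theorem exists_adj_mul_le_sub_of_le_discGrad [Finite V] {G : SimpleGraph V} {h : ℝ} (hh : 0 < h)
    {u : V → ℝ} {x : V} {c : ℝ} (hx : ∃ y, G.Adj x y) (hc : c ≤ discGrad G h u x) :
    ∃ y, G.Adj x y ∧ h * c ≤ u x - u y := by
  have hne : ((fun y => (u x - u y) / h) '' {y | G.Adj x y}).Nonempty := Set.Nonempty.image _ hx
  obtain ⟨y, hy, hyx⟩ := hne.csSup_mem (Set.toFinite _)
  refine ⟨y, hy, ?_⟩
  have hc' : c ≤ (u x - u y) / h := hc.trans_eq hyx.symm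
  rw [le_div_iff₀ hh] at hc'
  linarith

theorem IsGraphPath.cons {G : SimpleGraph V} {N : ℕ} {p : ℕ → V} {x y z : V} (hxy : G.Adj x y)
    (hp : IsGraphPath G N p y z) :
    IsGraphPath G (N + 1) (fun n => n.casesOn x p) x z := by
  refine ⟨rfl, hp.2.1, fun i hi => ?_⟩
  cases i with
  | zero => simpa [hp.1] using hxy
  | succ i => exact hp.2.2 i (by omega)

theorem pathCost_cons (h : ℝ) (f g : V → ℝ) (N : ℕ) (p : ℕ → V) (x : V) :
    pathCost h f g (N + 1) (fun n => n.casesOn x p) = h * f x + pathCost h f g N p := by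
  rw [pathCost, Finset.sum_range_succ']
  change h * (∑ k ∈ Finset.range N, f (p k) + f x) + g (p N) = _
  rw [pathCost]
  ring

theorem bddBelow_pathCost (G : SimpleGraph V) {Γ : Finset V} (hΓ : Γ.Nonempty) {h : ℝ}
    (hh : 0 ≤ h) {f : V → ℝ} (hf : ∀ x, 0 ≤ f x) (g : V → ℝ) (x : V) :
    BddBelow {c : ℝ | ∃ y ∈ Γ, ∃ N : ℕ, ∃ p : ℕ → V,
      IsGraphPath G N p x y ∧ c = pathCost h f g N p} := by
  obtain ⟨z, -, hz⟩ := Γ.exists_min_image g hΓ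
  refine ⟨g z, ?_⟩
  rintro _ ⟨y, hy, N, p, hp, rfl⟩
  have hsum := mul_nonneg hh (Finset.sum_nonneg fun k (_ : k ∈ Finset.range N) => hf (p k))
  have hzy := hz y hy
  rw [pathCost, hp.2.1]
  linarith

/-- Following steepest descent of a supersolution from `x` leads to the boundary along a path
whose cost is at most the value of the supersolution at `x`. -/
theorem exists_path_pathCost_le_of_supersolution [Finite V] {G : SimpleGraph V} {Γ : Finset V}
    (hnb : ∀ x ∉ Γ, ∃ y, G.Adj x y) {h : ℝ} (hh : 0 < h) {f g v : V → ℝ}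
    (hf : ∀ x ∉ Γ, 0 < f x) (hv : ∀ x ∉ Γ, f x ≤ discGrad G h v x)
    (hbd : ∀ x ∈ Γ, g x ≤ v x) (x : V) :
    ∃ y ∈ Γ, ∃ N : ℕ, ∃ p : ℕ → V, IsGraphPath G N p x y ∧ pathCost h f g N p ≤ v x := by
  have : IsTrans V (InvImage (· < ·) v) := ⟨fun _ _ _ hab hbc => lt_trans hab hbc⟩
  have : Std.Irrefl (InvImage (· < ·) v) := ⟨fun a => lt_irrefl (v a)⟩
  induction x using (Finite.wellFounded_of_trans_of_irrefl (InvImage (· < ·) v)).induction with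
  | _ x ih =>
  by_cases hx : x ∈ Γ
  · exact ⟨x, hx, 0, fun _ => x, ⟨rfl, rfl, by simp⟩, by simpa [pathCost] using hbd x hx⟩
  · obtain ⟨y, hxy, hle⟩ := exists_adj_mul_le_sub_of_le_discGrad hh (hnb x hx) (hv x hx)
    have hpos := mul_pos hh (hf x hx)
    have hlt : v y < v x := by linarith
    obtain ⟨z, hz, N, p, hp, hcost⟩ := ih y hlt
    refine ⟨z, hz, N + 1, _, hp.cons hxy, ?_⟩
    rw [pathCost_cons]
    linarith

/-- Supersolutions lie above the value function: if `v` is a supersolution of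
`|Du|ₕ = f` on `V₀` with `v ≥ g` on `Γ`, then `v ≥ U` on `V`. -/
theorem supersolution_ge_valueFun [Fintype V] [Nonempty V]
    (G : SimpleGraph V) (Γ : Finset V) (hΓ : Γ.Nonempty)
    (hnb : ∀ x ∉ Γ, ∃ y, G.Adj x y)
    (h : ℝ) (hh : 0 < h)
    (f : V → ℝ) (hf0 : ∀ x ∉ Γ, 0 < f x) (hf : ∀ x, 0 ≤ f x)
    (hreach : ∀ x : V, ∃ y ∈ Γ, ∃ N : ℕ, ∃ p : ℕ → V, IsGraphPath G N p x y)
    (g : V → ℝ)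
    (hcompat : ∀ x ∈ Γ, ∀ y ∈ Γ, ∀ N : ℕ, ∀ p : ℕ → V,
      IsGraphPath G N p x y → g x ≤ pathCost h f g N p)
    (v : V → ℝ)
    (hv : ∀ x ∉ Γ, f x ≤ discGrad G h v x)
    (hbd : ∀ x ∈ Γ, g x ≤ v x) :
    ∀ x : V, valueFun G Γ h f g x ≤ v x := by
  intro x
  obtain ⟨y, hy, N, p, hp, hcost⟩ :=
    exists_path_pathCost_le_of_supersolution hnb hh hf0 hv hbd x
  exact (csInf_le (bddBelow_pathCost G hΓ hh.le hf g x) ⟨y, hy, N, p, hp, rfl⟩).trans hcost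
end
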